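/- Fix 0 < p < ∞ and let E ⊂ 𝕋 be a closed set of Lebesgue measure zero with complementary arcs {I_j} (so 𝕋 \ E = ∪ I_j). Then the following are equivalent: (a) ∫_𝕋 |log dist(ξ, E)|^p dm(ξ) < ∞; (b) ∑_j |I_j| · |log|I_j||^p < ∞; (c) ∑ |I| · |log|I||^{p-1} < ∞, where the last sum runs over all dyadic arcs I of 𝕋 that intersect E. -/

import Mathlib

open MeasureTheory Set
open scoped Classical

/-- The contribution of generation-`n` dyadic arcs (modelled as dyadic subintervals of `[0,1)`)
that meet `E` to the sum in condition (c): each such arc `I` contributes `|I| |log|I||^{p-1}`. -/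
noncomputable def dyadicGenSum (E : Set ℝ) (p : ℝ) (n : ℕ) : ℝ :=
  ∑ k ∈ Finset.range (2 ^ n),
    if ((Ico ((k : ℝ) / 2 ^ n) (((k : ℝ) + 1) / 2 ^ n)) ∩ E).Nonempty then
      ((2 : ℝ) ^ n)⁻¹ * |Real.log (((2 : ℝ) ^ n)⁻¹)| ^ (p - 1)
    else 0

theorem summable_iff_tsum_ofReal_ne_top {f : ℕ → ℝ} (hf : ∀ n, 0 ≤ f n) :
    Summable f ↔ ∑' n, ENNReal.ofReal (f n) ≠ ⊤ := by
  refine ⟨fun h => h.tsum_ofReal_ne_top, fun h => ?_⟩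
  simpa [hf] using ENNReal.summable_toReal h

/-- The partial sums `∑_{k ≤ N} k^{p-1}` are comparable to `N^p`. -/
theorem exists_sum_rpow_bounds {p : ℝ} (hp : 0 < p) :
    ∃ c > 0, ∃ C > 0, ∀ N : ℕ,
      c * (N : ℝ) ^ p ≤ ∑ k ∈ Finset.range N, ((k : ℝ) + 1) ^ (p - 1) ∧
      ∑ k ∈ Finset.range N, ((k : ℝ) + 1) ^ (p - 1) ≤ C * (N : ℝ) ^ p := by
  have key : ∀ k : ℕ, ((k : ℝ) + 1) ^ (p - 1) * (k + 1) = ((k : ℝ) + 1) ^ p := fun k => by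
    rw [← Real.rpow_add_one (by positivity)]; congr 1; ring
  have hratio : ∀ k : ℕ, (1 + -1 / ((k : ℝ) + 1)) ^ p * ((k : ℝ) + 1) ^ p = (k : ℝ) ^ p :=
    fun k => by
      have h : (1 + -1 / ((k : ℝ) + 1)) = k / (k + 1) := by field_simp; ring
      rw [h, Real.div_rpow (by positivity) (by positivity)]
      field_simp
  have hlin : ∀ k : ℕ, (1 + p * (-1 / ((k : ℝ) + 1))) * ((k : ℝ) + 1) ^ p =
      ((k : ℝ) + 1) ^ p - p * ((k : ℝ) + 1) ^ (p - 1) := fun k => by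
    rw [← key]; field_simp; ring
  have hge : ∀ k : ℕ, -1 ≤ -1 / ((k : ℝ) + 1) := fun k => by
    rw [le_div_iff₀ (by positivity)]; have : (0 : ℝ) ≤ k := by positivity
    linarith
  have hsum : ∀ N : ℕ, ∑ k ∈ Finset.range N, (((k : ℝ) + 1) ^ p - (k : ℝ) ^ p) = (N : ℝ) ^ p :=
    fun N => by
      have := Finset.sum_range_sub (fun k : ℕ => (k : ℝ) ^ p) N
      simpa [Real.zero_rpow hp.ne'] using this
  have hconst : ∀ N : ℕ, ∑ _k ∈ Finset.range N, (N : ℝ) ^ (p - 1) = (N : ℝ) ^ p := fun N => by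
    rcases Nat.eq_zero_or_pos N with rfl | hN
    · simp [Real.zero_rpow hp.ne']
    · have : (0 : ℝ) < N := by exact_mod_cast hN
      rw [Finset.sum_const, Finset.card_range, nsmul_eq_mul, mul_comm,
        ← Real.rpow_add_one this.ne']
      congr 1; ring
  rcases le_total p 1 with h1 | h1
  · refine ⟨1, one_pos, 1 / p, by positivity, fun N => ⟨?_, ?_⟩⟩
    · rw [one_mul, ← hconst]
      refine Finset.sum_le_sum fun k hk => ?_
      refine Real.rpow_le_rpow_of_nonpos (by positivity) ?_ (by linarith)
      exact_mod_cast Finset.mem_range.1 hk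
    · rw [← hsum, Finset.mul_sum]
      refine Finset.sum_le_sum fun k _ => ?_
      have := mul_le_mul_of_nonneg_right
        (rpow_one_add_le_one_add_mul_self (hge k) hp.le h1)
        (by positivity : 0 ≤ ((k : ℝ) + 1) ^ p)
      rw [hratio, hlin] at this
      rw [one_div, ← div_eq_inv_mul, le_div_iff₀ hp]
      linarith
  · refine ⟨1 / p, by positivity, 1, one_pos, fun N => ⟨?_, ?_⟩⟩
    · rw [← hsum, Finset.mul_sum]
      refine Finset.sum_le_sum fun k _ => ?_
      have := mul_le_mul_of_nonneg_right
        (one_add_mul_self_le_rpow_one_add (hge k) h1)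
        (by positivity : 0 ≤ ((k : ℝ) + 1) ^ p)
      rw [hratio, hlin] at this
      rw [one_div, ← div_eq_inv_mul, div_le_iff₀ hp]
      linarith
    · rw [one_mul, ← hconst]
      refine Finset.sum_le_sum fun k hk => ?_
      refine Real.rpow_le_rpow (by positivity) ?_ (by linarith)
      exact_mod_cast Finset.mem_range.1 hk

/-- For `0 < t ≤ 1/2`, the sum of `n^{p-1}` over the `n ≥ 1` with `t ≤ 2⁻ⁿ` is comparable to
`|log t|^p`. -/
theorem exists_tsum_layer_bounds {p : ℝ} (hp : 0 < p) :
    ∃ c > 0, ∃ C > 0, ∀ t : ℝ, 0 < t → t ≤ 1 / 2 →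
      ENNReal.ofReal (c * |Real.log t| ^ p) ≤
        ∑' n : ℕ, (if t ≤ ((2 : ℝ) ^ (n + 1))⁻¹ then
          ENNReal.ofReal (((n : ℝ) + 1) ^ (p - 1)) else 0) ∧
      ∑' n : ℕ, (if t ≤ ((2 : ℝ) ^ (n + 1))⁻¹ then
          ENNReal.ofReal (((n : ℝ) + 1) ^ (p - 1)) else 0) ≤
        ENNReal.ofReal (C * |Real.log t| ^ p) := by
  obtain ⟨c, hc, C, hC, hcC⟩ := exists_sum_rpow_bounds hp
  have hl : 0 < Real.log 2 := Real.log_pos one_lt_two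
  refine ⟨c * ((2 * Real.log 2) ^ p)⁻¹, by positivity, C * ((Real.log 2) ^ p)⁻¹, by positivity,
    fun t ht ht2 => ?_⟩
  set L := -Real.log t / Real.log 2 with hL
  have hlog : Real.log t ≤ -Real.log 2 := by
    rw [← Real.log_inv]; exact Real.log_le_log ht (by linarith)
  have habs : |Real.log t| = L * Real.log 2 := by
    rw [abs_of_neg (by linarith), hL]; field_simp
  have hL1 : 1 ≤ L := by rw [hL, le_div_iff₀ hl]; linarith
  have hiff : ∀ n : ℕ, t ≤ ((2 : ℝ) ^ (n + 1))⁻¹ ↔ n ∈ Finset.range ⌊L⌋₊ := fun n => by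
    rw [Finset.mem_range, ← Nat.add_one_le_iff, Nat.le_floor_iff (by linarith),
      ← Real.log_le_log_iff ht (by positivity), Real.log_inv, Real.log_pow, hL, le_div_iff₀ hl,
      le_neg]
  have hsum : ∑' n : ℕ, (if t ≤ ((2 : ℝ) ^ (n + 1))⁻¹ then
      ENNReal.ofReal (((n : ℝ) + 1) ^ (p - 1)) else 0) =
      ENNReal.ofReal (∑ k ∈ Finset.range ⌊L⌋₊, ((k : ℝ) + 1) ^ (p - 1)) := by
    rw [ENNReal.ofReal_sum_of_nonneg (fun _ _ => by positivity),
      tsum_eq_sum (s := Finset.range ⌊L⌋₊) (fun n hn => if_neg (by rwa [hiff]))]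
    exact Finset.sum_congr rfl fun n hn => if_pos ((hiff n).2 hn)
  have hN1 : (1 : ℝ) ≤ ⌊L⌋₊ := by exact_mod_cast Nat.le_floor (by simpa using hL1)
  have hNL : (⌊L⌋₊ : ℝ) ≤ L := Nat.floor_le (by linarith)
  have hLN : L ≤ 2 * ⌊L⌋₊ := by have := Nat.lt_floor_add_one L; linarith
  obtain ⟨h1, h2⟩ := hcC ⌊L⌋₊
  rw [hsum, habs]
  constructor <;> apply ENNReal.ofReal_le_ofReal
  · refine le_trans ?_ h1
    rw [mul_assoc]
    gcongr
    rw [inv_mul_le_iff₀ (by positivity), ← Real.mul_rpow (by positivity) (by positivity)]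
    refine Real.rpow_le_rpow (by positivity) ?_ hp.le
    nlinarith
  · refine h2.trans ?_
    rw [Real.mul_rpow (by linarith) hl.le, mul_assoc]
    gcongr
    rw [mul_comm (L ^ p), inv_mul_cancel_left₀ (by positivity)]
    gcongr

/-- The indices of the dyadic intervals of generation `n` in `[0,1)` that meet `E`. -/
noncomputable def dyadicMeeting (E : Set ℝ) (n : ℕ) : Finset ℕ :=
  (Finset.range (2 ^ n)).filter fun k : ℕ =>
    ((Ico ((k : ℝ) / 2 ^ n) (((k : ℝ) + 1) / 2 ^ n)) ∩ E).Nonempty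

theorem dyadicGenSum_succ (E : Set ℝ) (p : ℝ) (n : ℕ) :
    dyadicGenSum E p (n + 1) = Real.log 2 ^ (p - 1) * (((n : ℝ) + 1) ^ (p - 1) *
      ((dyadicMeeting E (n + 1)).card * ((2 : ℝ) ^ (n + 1))⁻¹)) := by
  have hl : 0 < Real.log 2 := Real.log_pos one_lt_two
  have hlog : |Real.log (((2 : ℝ) ^ (n + 1))⁻¹)| = ((n : ℝ) + 1) * Real.log 2 := by
    rw [Real.log_inv, abs_neg, Real.log_pow, abs_of_nonneg (by positivity)]; push_cast; rfl
  rw [dyadicGenSum, ← Finset.sum_filter, Finset.sum_const, nsmul_eq_mul, hlog,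
    Real.mul_rpow (by positivity) hl.le, dyadicMeeting]
  ring

/-- Up to constants, the dyadic intervals of generation `n` meeting `E` measure the
`2⁻ⁿ`-neighbourhood of `E`. -/
theorem volume_neighborhood_bounds {E : Set ℝ} (hclosed : IsClosed E) (hsub : E ⊆ Icc 0 1)
    (h0 : (0 : ℝ) ∈ E) (n : ℕ) :
    ENNReal.ofReal ((dyadicMeeting E n).card * ((2 : ℝ) ^ n)⁻¹) ≤
        volume {x ∈ Icc (0 : ℝ) 1 | Metric.infDist x E ≤ ((2 : ℝ) ^ n)⁻¹} ∧
      volume {x ∈ Icc (0 : ℝ) 1 | Metric.infDist x E ≤ ((2 : ℝ) ^ n)⁻¹} ≤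
        ENNReal.ofReal (4 * ((dyadicMeeting E n).card * ((2 : ℝ) ^ n)⁻¹)) := by
  set K := dyadicMeeting E n
  have h2 : (0 : ℝ) < 2 ^ n := by positivity
  have hcast : ∀ {k : ℕ}, k < 2 ^ n → (k : ℝ) + 1 ≤ 2 ^ n := fun hk => by exact_mod_cast hk
  constructor
  · have hvol : ∀ k : ℕ, volume (Ico ((k : ℝ) / 2 ^ n) (((k : ℝ) + 1) / 2 ^ n)) =
        ENNReal.ofReal ((2 : ℝ) ^ n)⁻¹ := fun k => by
      rw [Real.volume_Ico]; congr 1; field_simp; ring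
    have hpd : (K : Set ℕ).PairwiseDisjoint
        fun k : ℕ => Ico ((k : ℝ) / 2 ^ n) (((k : ℝ) + 1) / 2 ^ n) := by
      intro i _ j _ hij
      refine Set.disjoint_left.2 fun x hi hj => hij ?_
      simp only [mem_Ico, div_le_iff₀ h2, lt_div_iff₀ h2] at hi hj
      have h3 : (i : ℝ) < j + 1 := by linarith
      have h4 : (j : ℝ) < i + 1 := by linarith
      norm_cast at h3 h4
      omega
    have hU := measure_biUnion_finset (μ := volume) hpd fun k _ => measurableSet_Ico
    simp only [hvol, Finset.sum_const, nsmul_eq_mul] at hU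
    rw [ENNReal.ofReal_mul (by positivity), ENNReal.ofReal_natCast, ← hU]
    refine measure_mono (iUnion₂_subset fun k hk x hx => ?_)
    obtain ⟨hk, e, he, heE⟩ := Finset.mem_filter.1 hk
    have := hcast (Finset.mem_range.1 hk)
    have hk0 : (0 : ℝ) ≤ k := by positivity
    refine ⟨⟨(by positivity : (0 : ℝ) ≤ k / 2 ^ n).trans hx.1,
      hx.2.le.trans ((div_le_one h2).2 this)⟩, (Metric.infDist_le_dist_of_mem heE).trans ?_⟩
    have hd : ((k : ℝ) + 1) / 2 ^ n = k / 2 ^ n + (2 ^ n)⁻¹ := by field_simp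
    rw [Real.dist_eq, abs_le]
    rw [hd] at hx he
    constructor <;> linarith [hx.1, hx.2, he.1, he.2]
  · have hcard : (1 : ℝ) ≤ K.card := by
      have : 0 ∈ K := by
        refine Finset.mem_filter.2 ⟨by simp, 0, ⟨by simp, by simp⟩, h0⟩
      exact_mod_cast Finset.card_pos.2 ⟨0, this⟩
    have hcov : {x ∈ Icc (0 : ℝ) 1 | Metric.infDist x E ≤ ((2 : ℝ) ^ n)⁻¹} ⊆
        (⋃ k ∈ K, Icc (((k : ℝ) - 1) / 2 ^ n) (((k : ℝ) + 2) / 2 ^ n)) ∪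
          Icc (1 - ((2 : ℝ) ^ n)⁻¹) 1 := by
      rintro x ⟨hx, hxd⟩
      obtain ⟨e, heE, hed⟩ := hclosed.exists_infDist_eq_dist ⟨0, h0⟩ x
      rw [hed, Real.dist_eq, abs_le] at hxd
      obtain ⟨he0, he1⟩ := hsub heE
      rcases he1.lt_or_eq with he1 | rfl
      · left
        have hfl := Nat.floor_le (by positivity : 0 ≤ e * 2 ^ n)
        have hlf := Nat.lt_floor_add_one (e * 2 ^ n)
        have hlt : ⌊e * 2 ^ n⌋₊ < 2 ^ n := by
          rw [Nat.floor_lt (by positivity)]; push_cast; nlinarith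
        have h2i : (2 : ℝ) ^ n * (2 ^ n)⁻¹ = 1 := mul_inv_cancel₀ h2.ne'
        refine mem_iUnion₂.2 ⟨⌊e * 2 ^ n⌋₊, Finset.mem_filter.2 ⟨Finset.mem_range.2 hlt, e,
          ⟨(div_le_iff₀ h2).2 hfl, (lt_div_iff₀ h2).2 hlf⟩, heE⟩,
          (div_le_iff₀ h2).2 ?_, (le_div_iff₀ h2).2 ?_⟩ <;> nlinarith
      · right; exact ⟨by linarith [hxd.1], hx.2⟩
    refine (measure_mono hcov).trans ((measure_union_le _ _).trans ?_)
    have hvol : ∀ k : ℕ, volume (Icc (((k : ℝ) - 1) / 2 ^ n) (((k : ℝ) + 2) / 2 ^ n)) =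
        ENNReal.ofReal (3 * ((2 : ℝ) ^ n)⁻¹) := fun k => by
      rw [Real.volume_Icc]; congr 1; field_simp; ring
    have hU := measure_biUnion_finset_le (μ := volume) K
      fun k : ℕ => Icc (((k : ℝ) - 1) / 2 ^ n) (((k : ℝ) + 2) / 2 ^ n)
    simp only [hvol, Finset.sum_const, nsmul_eq_mul] at hU
    refine (add_le_add_left hU _).trans ?_
    rw [Real.volume_Icc, ← ENNReal.ofReal_natCast, ← ENNReal.ofReal_mul (by positivity),
      ← ENNReal.ofReal_add (by positivity) (by simp)]
    refine ENNReal.ofReal_le_ofReal ?_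
    have : (0 : ℝ) < (2 ^ n)⁻¹ := by positivity
    nlinarith

theorem infDist_le_half {E : Set ℝ} (h0 : (0 : ℝ) ∈ E) (h1 : (1 : ℝ) ∈ E) {x : ℝ}
    (hx : x ∈ Icc (0 : ℝ) 1) : Metric.infDist x E ≤ 1 / 2 := by
  have h2 := Metric.infDist_le_dist_of_mem h0 (x := x)
  have h3 := Metric.infDist_le_dist_of_mem h1 (x := x)
  rw [Real.dist_eq, abs_of_nonneg (by linarith [hx.1])] at h2
  rw [Real.dist_eq, abs_of_nonpos (by linarith [hx.2])] at h3
  linarith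

/-- Layer-cake comparison of the logarithmic distance integral with the dyadic sum. -/
theorem lintegral_log_infDist_ne_top_iff_summable_dyadicGenSum {p : ℝ} (hp : 0 < p) {E : Set ℝ}
    (hclosed : IsClosed E) (hsub : E ⊆ Icc 0 1) (h0 : (0 : ℝ) ∈ E) (h1 : (1 : ℝ) ∈ E)
    (hzero : volume E = 0) :
    ∫⁻ x in Icc (0 : ℝ) 1, ENNReal.ofReal (|Real.log (Metric.infDist x E)| ^ p) ≠ ⊤ ↔
      Summable (dyadicGenSum E p) := by
  have hl : 0 < Real.log 2 := Real.log_pos one_lt_two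
  set δ : ℝ → ℝ := fun x => Metric.infDist x E
  have hδm : Measurable δ := (Metric.continuous_infDist_pt E).measurable
  obtain ⟨c, hc, C, hC, hcC⟩ := exists_tsum_layer_bounds hp
  set F : ℝ → ENNReal := fun x => ∑' n : ℕ, (if δ x ≤ ((2 : ℝ) ^ (n + 1))⁻¹ then
    ENNReal.ofReal (((n : ℝ) + 1) ^ (p - 1)) else 0) with hF
  have hpos : ∀ᵐ x ∂(volume.restrict (Icc (0 : ℝ) 1)), 0 < δ x ∧ δ x ≤ 1 / 2 := by
    have hE : ∀ᵐ x ∂(volume.restrict (Icc (0 : ℝ) 1)), x ∉ E :=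
      ae_restrict_of_ae (measure_eq_zero_iff_ae_notMem.1 hzero)
    filter_upwards [hE, ae_restrict_mem measurableSet_Icc] with x hx hx'
    exact ⟨(hclosed.notMem_iff_infDist_pos ⟨0, h0⟩).1 hx, infDist_le_half h0 h1 hx'⟩
  have hFint : ∫⁻ x in Icc (0 : ℝ) 1, F x = ∑' n : ℕ, ENNReal.ofReal (((n : ℝ) + 1) ^ (p - 1)) *
      volume {x ∈ Icc (0 : ℝ) 1 | δ x ≤ ((2 : ℝ) ^ (n + 1))⁻¹} := by
    have hms : ∀ n : ℕ, MeasurableSet {x | δ x ≤ ((2 : ℝ) ^ (n + 1))⁻¹} := fun n =>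
      measurableSet_le hδm measurable_const
    rw [hF, lintegral_tsum fun n => (Measurable.ite (hms n) measurable_const
      measurable_const).aemeasurable]
    refine tsum_congr fun n => ?_
    have := lintegral_indicator_const (μ := volume.restrict (Icc (0 : ℝ) 1)) (hms n)
      (ENNReal.ofReal (((n : ℝ) + 1) ^ (p - 1)))
    rw [Measure.restrict_apply (hms n), inter_comm] at this
    exact this
  have hG : ∀ A : ℝ, 0 ≤ A → ∫⁻ x in Icc (0 : ℝ) 1, ENNReal.ofReal (A * |Real.log (δ x)| ^ p) =
      ENNReal.ofReal A * ∫⁻ x in Icc (0 : ℝ) 1, ENNReal.ofReal (|Real.log (δ x)| ^ p) :=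
    fun A hA => by
      simp only [ENNReal.ofReal_mul hA]
      exact lintegral_const_mul' _ _ ENNReal.ofReal_ne_top
  have hint : ∫⁻ x in Icc (0 : ℝ) 1, ENNReal.ofReal (|Real.log (δ x)| ^ p) ≠ ⊤ ↔
      ∫⁻ x in Icc (0 : ℝ) 1, F x ≠ ⊤ := by
    constructor <;> intro h
    · refine ne_top_of_le_ne_top (ENNReal.mul_ne_top (ENNReal.ofReal_ne_top (r := C)) h) ?_
      rw [← hG C hC.le]
      exact lintegral_mono_ae (hpos.mono fun x hx => (hcC _ hx.1 hx.2).2)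
    · have : ∫⁻ x in Icc (0 : ℝ) 1, ENNReal.ofReal (c * |Real.log (δ x)| ^ p) ≠ ⊤ :=
        ne_top_of_le_ne_top h (lintegral_mono_ae (hpos.mono fun x hx => (hcC _ hx.1 hx.2).1))
      rw [hG c hc.le] at this
      exact fun htop => this (by rw [htop, ENNReal.mul_top (by simpa using hc)])
  rw [hint, hFint, ← summable_nat_add_iff 1]
  simp only [dyadicGenSum_succ]
  rw [summable_mul_left_iff (by positivity),
    summable_iff_tsum_ofReal_ne_top (fun n => by positivity)]
  have hb := fun n : ℕ => volume_neighborhood_bounds hclosed hsub h0 (n + 1)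
  constructor <;> intro h
  · refine ne_top_of_le_ne_top h (ENNReal.tsum_le_tsum fun n => ?_)
    rw [ENNReal.ofReal_mul (by positivity)]
    gcongr
    exact (hb n).1
  · refine ne_top_of_le_ne_top (ENNReal.mul_ne_top (ENNReal.ofReal_ne_top (r := 4)) h) ?_
    rw [← ENNReal.tsum_mul_left]
    refine ENNReal.tsum_le_tsum fun n => ?_
    rw [← ENNReal.ofReal_mul (by norm_num), mul_left_comm, ENNReal.ofReal_mul (by positivity)]
    gcongr
    exact (hb n).2

theorem abs_log_rpow_le {p : ℝ} (hp : 0 < p) {t l : ℝ} (ht : 0 < t) (htl : t ≤ l) :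
    |Real.log t| ^ p ≤
      2 ^ p * |Real.log l| ^ p + 2 ^ p * (2 * p) ^ p * l ^ (1 / 2 : ℝ) * t ^ (-1 / 2 : ℝ) := by
  have hl : 0 < l := ht.trans_le htl
  have hq : 1 ≤ l / t := (one_le_div ht).2 htl
  have hlog : Real.log t = Real.log l - Real.log (l / t) := by
    rw [Real.log_div hl.ne' ht.ne']; ring
  have hs : Real.log (l / t) ^ p ≤ (2 * p) ^ p * (l ^ (1 / 2 : ℝ) * t ^ (-1 / 2 : ℝ)) := by
    have h := Real.log_le_rpow_div (by positivity : 0 ≤ l / t)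
      (by positivity : 0 < 1 / (2 * p))
    have h' := Real.rpow_le_rpow (Real.log_nonneg hq) h hp.le
    refine h'.trans_eq ?_
    rw [Real.div_rpow (by positivity) (by positivity), ← Real.rpow_mul (by positivity),
      Real.div_rpow hl.le ht.le, Real.div_rpow (by norm_num) (by positivity), Real.one_rpow,
      show 1 / (2 * p) * p = 1 / 2 by field_simp,
      show (-1 / 2 : ℝ) = -(1 / 2) by norm_num, Real.rpow_neg ht.le]
    field_simp
  have h1 : |Real.log t| ≤ 2 * max |Real.log l| (Real.log (l / t)) := by
    rw [hlog]
    have h2 := abs_sub (Real.log l) (Real.log (l / t))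
    rw [abs_of_nonneg (Real.log_nonneg hq)] at h2
    linarith [le_max_left |Real.log l| (Real.log (l / t)),
      le_max_right |Real.log l| (Real.log (l / t))]
  have h2 := Real.rpow_le_rpow (abs_nonneg _) h1 hp.le
  have h0 := Real.log_nonneg hq
  rw [Real.mul_rpow (by norm_num) (by positivity)] at h2
  have h3 : max |Real.log l| (Real.log (l / t)) ^ p ≤
      |Real.log l| ^ p + Real.log (l / t) ^ p := by
    rcases max_cases |Real.log l| (Real.log (l / t)) with h | h <;> rw [h.1]
    · linarith [Real.rpow_nonneg h0 p]
    · linarith [Real.rpow_nonneg (abs_nonneg (Real.log l)) p]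
  calc |Real.log t| ^ p ≤ 2 ^ p * max |Real.log l| (Real.log (l / t)) ^ p := h2
    _ ≤ 2 ^ p * (|Real.log l| ^ p + (2 * p) ^ p * (l ^ (1 / 2 : ℝ) * t ^ (-1 / 2 : ℝ))) := by
      gcongr; linarith
    _ = _ := by ring

theorem lintegral_abs_log_rpow_le {p : ℝ} (hp : 0 < p) {l : ℝ} (hl : 0 < l) :
    ∫⁻ t in Ioo 0 l, ENNReal.ofReal (|Real.log t| ^ p) ≤
      ENNReal.ofReal (2 ^ p * (l * |Real.log l| ^ p) + 2 * 2 ^ p * (2 * p) ^ p * l) := by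
  set A := 2 ^ p * |Real.log l| ^ p with hA
  set B := 2 ^ p * (2 * p) ^ p * l ^ (1 / 2 : ℝ) with hB
  have hii : IntervalIntegrable (fun t : ℝ => A + B * t ^ (-1 / 2 : ℝ)) volume 0 l :=
    intervalIntegrable_const.add
      ((intervalIntegral.intervalIntegrable_rpow' (by norm_num)).const_mul B)
  have hi : IntegrableOn (fun t : ℝ => A + B * t ^ (-1 / 2 : ℝ)) (Ioo 0 l) :=
    ((intervalIntegrable_iff_integrableOn_Ioc_of_le hl.le).1 hii).mono_set Ioo_subset_Ioc_self
  have hval : ∫ t in Ioo 0 l, (A + B * t ^ (-1 / 2 : ℝ)) =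
      2 ^ p * (l * |Real.log l| ^ p) + 2 * 2 ^ p * (2 * p) ^ p * l := by
    rw [← integral_Ioc_eq_integral_Ioo, ← intervalIntegral.integral_of_le hl.le,
      intervalIntegral.integral_add intervalIntegrable_const
        ((intervalIntegral.intervalIntegrable_rpow' (by norm_num)).const_mul B),
      intervalIntegral.integral_const, intervalIntegral.integral_const_mul,
      integral_rpow (Or.inl (by norm_num)), Real.zero_rpow (by norm_num)]
    have hll : l ^ (1 / 2 : ℝ) * l ^ (1 / 2 : ℝ) = l := by
      rw [← Real.rpow_add hl]; norm_num
    rw [show (-1 / 2 + 1 : ℝ) = 1 / 2 by norm_num, hA, hB]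
    simp only [smul_eq_mul, sub_zero]
    linear_combination 2 * 2 ^ p * (2 * p) ^ p * hll
  rw [← hval, ofReal_integral_eq_lintegral_ofReal hi]
  · exact setLIntegral_mono' measurableSet_Ioo fun t ht =>
      ENNReal.ofReal_le_ofReal (abs_log_rpow_le hp ht.1 ht.2.le)
  · filter_upwards [ae_restrict_mem measurableSet_Ioo] with t ht
    have := ht.1
    simp only [Pi.zero_apply]
    positivity

theorem lintegral_log_sub_add_log_sub {p : ℝ} (a b : ℝ) :
    ∫⁻ x in Ioo a b, (ENNReal.ofReal (|Real.log (x - a)| ^ p) +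
        ENNReal.ofReal (|Real.log (b - x)| ^ p)) =
      2 * ∫⁻ t in Ioo 0 (b - a), ENNReal.ofReal (|Real.log t| ^ p) := by
  have hm : Measurable fun x : ℝ => ENNReal.ofReal (|Real.log x| ^ p) := by fun_prop
  rw [lintegral_add_left (by fun_prop), two_mul]
  congr 1
  · have := (measurePreserving_sub_right volume a).setLIntegral_comp_preimage
      (measurableSet_Ioo (a := (0 : ℝ)) (b := b - a)) hm
    simpa using this
  · have := (Measure.measurePreserving_sub_left volume b).setLIntegral_comp_preimage
      (measurableSet_Ioo (a := (0 : ℝ)) (b := b - a)) hm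
    simpa using this

/-- The logarithmic distance integral over the complementary arcs against the sum over arcs. -/
theorem lintegral_log_infDist_ne_top_iff_summable_arcs {p : ℝ} (hp : 0 < p) {E : Set ℝ}
    (hclosed : IsClosed E) (h0 : (0 : ℝ) ∈ E) (h1 : (1 : ℝ) ∈ E)
    (hzero : volume E = 0) {a b : ℕ → ℝ} (hab : ∀ j, a j ≤ b j)
    (hdisj : Pairwise fun i j => Disjoint (Ioo (a i) (b i)) (Ioo (a j) (b j)))
    (hcover : Icc (0 : ℝ) 1 \ E = ⋃ j, Ioo (a j) (b j)) :
    ∫⁻ x in Icc (0 : ℝ) 1, ENNReal.ofReal (|Real.log (Metric.infDist x E)| ^ p) ≠ ⊤ ↔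
      Summable fun j => (b j - a j) * |Real.log (b j - a j)| ^ p := by
  have hsubI : ∀ j, Ioo (a j) (b j) ⊆ Icc 0 1 \ E := fun j => by
    rw [hcover]; exact subset_iUnion (fun j => Ioo (a j) (b j)) j
  have hends : ∀ j, a j < b j → 0 ≤ a j ∧ b j ≤ 1 := fun j hj => by
    have := closure_minimal ((hsubI j).trans sdiff_subset) isClosed_Icc
    rw [closure_Ioo hj.ne] at this
    exact ⟨(this (left_mem_Icc.2 hj.le)).1, (this (right_mem_Icc.2 hj.le)).2⟩
  have hle1 : ∀ j, b j - a j ≤ 1 := fun j => by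
    rcases (hab j).lt_or_eq with h | h
    · linarith [hends j h]
    · linarith
  have haE : ∀ j, a j < b j → a j ∈ E := fun j hj => by
    by_contra hn
    have hmem : a j ∈ Icc (0 : ℝ) 1 \ E := ⟨⟨(hends j hj).1, hj.le.trans (hends j hj).2⟩, hn⟩
    rw [hcover] at hmem
    obtain ⟨i, hi⟩ := mem_iUnion.1 hmem
    have hij : i ≠ j := by rintro rfl; exact lt_irrefl _ hi.1
    obtain ⟨y, hy1, hy2⟩ := exists_between (lt_min hj hi.2)
    exact Set.disjoint_left.1 (hdisj hij) ⟨hi.1.trans hy1, hy2.trans_le (min_le_right _ _)⟩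
      ⟨hy1, hy2.trans_le (min_le_left _ _)⟩
  have hpos : ∀ j, ∀ x ∈ Ioo (a j) (b j), 0 < Metric.infDist x E := fun j x hx =>
    (hclosed.notMem_iff_infDist_pos ⟨0, h0⟩).1 (hsubI j hx).2
  have hhalf : ∀ j, ∀ x ∈ Ioo (a j) (b j), Metric.infDist x E ≤ 1 / 2 := fun j x hx =>
    infDist_le_half h0 h1 (hsubI j hx).1
  have hsplit : ∫⁻ x in Icc (0 : ℝ) 1, ENNReal.ofReal (|Real.log (Metric.infDist x E)| ^ p) =
      ∑' j, ∫⁻ x in Ioo (a j) (b j), ENNReal.ofReal (|Real.log (Metric.infDist x E)| ^ p) := by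
    rw [← lintegral_iUnion (fun _ => measurableSet_Ioo) hdisj, ← hcover]
    exact setLIntegral_congr (sdiff_null_ae_eq_self hzero).symm
  have hlen : ∑' j, ENNReal.ofReal (b j - a j) ≠ ⊤ := by
    have : ∑' j, ENNReal.ofReal (b j - a j) = volume (Icc (0 : ℝ) 1 \ E) := by
      rw [hcover, measure_iUnion hdisj fun _ => measurableSet_Ioo]
      simp
    rw [this]
    exact measure_ne_top_of_subset sdiff_subset (by simp)
  have hterm : ∀ j, 0 ≤ (b j - a j) * |Real.log (b j - a j)| ^ p := fun j =>
    mul_nonneg (sub_nonneg.2 (hab j)) (by positivity)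
  rw [summable_iff_tsum_ofReal_ne_top hterm, hsplit]
  constructor <;> intro h
  · refine ne_top_of_le_ne_top h (ENNReal.tsum_le_tsum fun j => ?_)
    have hconst : ENNReal.ofReal ((b j - a j) * |Real.log (b j - a j)| ^ p) =
        ∫⁻ _x in Ioo (a j) (b j), ENNReal.ofReal (|Real.log (b j - a j)| ^ p) := by
      rw [setLIntegral_const, Real.volume_Ioo, mul_comm, ENNReal.ofReal_mul (by positivity)]
    rw [hconst]
    refine setLIntegral_mono' measurableSet_Ioo fun x hx => ENNReal.ofReal_le_ofReal ?_
    have hj := hx.1.trans hx.2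
    have hd := Metric.infDist_le_dist_of_mem (haE j hj) (x := x)
    rw [Real.dist_eq, abs_of_pos (sub_pos.2 hx.1)] at hd
    refine Real.rpow_le_rpow (abs_nonneg _) ?_ hp.le
    have hp0 := hpos j x hx
    rw [abs_of_nonpos (Real.log_nonpos (by linarith) (hle1 j)),
      abs_of_nonpos (Real.log_nonpos hp0.le (by linarith [hhalf j x hx]))]
    exact neg_le_neg (Real.log_le_log hp0 (by linarith [hx.2]))
  · have hup : ∀ j, ∫⁻ x in Ioo (a j) (b j),
        ENNReal.ofReal (|Real.log (Metric.infDist x E)| ^ p) ≤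
        2 * (ENNReal.ofReal (2 ^ p) * ENNReal.ofReal ((b j - a j) * |Real.log (b j - a j)| ^ p) +
          ENNReal.ofReal (2 * 2 ^ p * (2 * p) ^ p) * ENNReal.ofReal (b j - a j)) := fun j => by
      rcases (hab j).lt_or_eq with hj | hj
      swap
      · simp [hj]
      have hl : 0 < b j - a j := sub_pos.2 hj
      rw [← ENNReal.ofReal_mul (by positivity), ← ENNReal.ofReal_mul (by positivity),
        ← ENNReal.ofReal_add (by positivity) (by positivity)]
      refine le_trans ?_ (mul_le_mul_right (lintegral_abs_log_rpow_le hp hl) 2)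
      rw [← lintegral_log_sub_add_log_sub]
      refine setLIntegral_mono' measurableSet_Ioo fun x hx => ?_
      have hp0 := hpos j x hx
      have hlog0 := Real.log_nonpos hp0.le (by linarith [hhalf j x hx])
      have hmono : ∀ s : ℝ, 0 < s → s ≤ Metric.infDist x E →
          ENNReal.ofReal (|Real.log (Metric.infDist x E)| ^ p) ≤
            ENNReal.ofReal (|Real.log s| ^ p) := fun s hs hsd => by
        refine ENNReal.ofReal_le_ofReal (Real.rpow_le_rpow (abs_nonneg _) ?_ hp.le)
        rw [abs_of_nonpos hlog0]
        exact (neg_le_neg (Real.log_le_log hs hsd)).trans (neg_le_abs _)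
      obtain ⟨e, heE, hed⟩ := hclosed.exists_infDist_eq_dist ⟨0, h0⟩ x
      have he : e ∉ Ioo (a j) (b j) := fun he => (hsubI j he).2 heE
      rw [Real.dist_eq] at hed
      rcases le_or_gt e (a j) with hea | hea
      · refine (hmono (x - a j) (sub_pos.2 hx.1) ?_).trans le_self_add
        linarith [le_abs_self (x - e)]
      · refine (hmono (b j - x) (sub_pos.2 hx.2) ?_).trans le_add_self
        have : b j ≤ e := not_lt.1 fun h => he ⟨hea, h⟩
        linarith [neg_le_abs (x - e)]
    refine ne_top_of_le_ne_top ?_ (ENNReal.tsum_le_tsum hup)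
    rw [ENNReal.tsum_mul_left, ENNReal.tsum_add, ENNReal.tsum_mul_left, ENNReal.tsum_mul_left]
    exact ENNReal.mul_ne_top (by simp) (ENNReal.add_ne_top.2
      ⟨ENNReal.mul_ne_top ENNReal.ofReal_ne_top h, ENNReal.mul_ne_top ENNReal.ofReal_ne_top hlen⟩)

theorem integrableOn_log_infDist_iff {p : ℝ} (E : Set ℝ) (s : Set ℝ) :
    IntegrableOn (fun x => |Real.log (Metric.infDist x E)| ^ p) s ↔
      ∫⁻ x in s, ENNReal.ofReal (|Real.log (Metric.infDist x E)| ^ p) ≠ ⊤ := by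
  have hm : Measurable fun x => |Real.log (Metric.infDist x E)| ^ p := by
    have := (Metric.continuous_infDist_pt E).measurable
    fun_prop
  rw [IntegrableOn, Integrable, and_iff_right hm.aestronglyMeasurable,
    hasFiniteIntegral_iff_ofReal (Filter.Eventually.of_forall fun x => by positivity),
    lt_top_iff_ne_top]

/-- Characterizations of `𝒞(p)`-Beurling–Carleson sets (circle modelled as `[0,1]` with endpoints
identified, the set `E` containing the cut point): for a closed set `E ⊆ [0,1]` of Lebesgue
measure zero with complementary arcs `(a j, b j)`, the following are equivalent:
(a) `∫ |log dist(⬝,E)|^p < ∞`; (b) `∑ |I_j| |log|I_j||^p < ∞`;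
(c) `∑ |I| |log|I||^{p-1} < ∞` over dyadic arcs `I` meeting `E`. -/
theorem beurling_carleson_characterizations
    (p : ℝ) (hp : 0 < p) (E : Set ℝ) (hclosed : IsClosed E) (hsub : E ⊆ Icc 0 1)
    (h0 : (0:ℝ) ∈ E) (h1 : (1:ℝ) ∈ E) (hzero : volume E = 0)
    (a b : ℕ → ℝ) (hab : ∀ j, a j ≤ b j)
    (hdisj : Pairwise fun i j => Disjoint (Ioo (a i) (b i)) (Ioo (a j) (b j)))
    (hcover : Icc (0:ℝ) 1 \ E = ⋃ j, Ioo (a j) (b j)) :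
    ((IntegrableOn (fun x => |Real.log (Metric.infDist x E)| ^ p) (Icc (0:ℝ) 1)) ↔
        Summable fun j => (b j - a j) * |Real.log (b j - a j)| ^ p) ∧
      ((Summable fun j => (b j - a j) * |Real.log (b j - a j)| ^ p) ↔
        Summable (dyadicGenSum E p)) := by
  have hc := lintegral_log_infDist_ne_top_iff_summable_dyadicGenSum hp hclosed hsub h0 h1 hzero
  have hb := lintegral_log_infDist_ne_top_iff_summable_arcs hp hclosed h0 h1 hzero hab hdisj hcover
  rw [integrableOn_log_infDist_iff]
  exact ⟨hb, hb.symm.trans hc⟩
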